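/- Let G = (V₁,E₁) be a connected graph with |V₁| ≥ 2 and let K̄_n be the empty graph on n ≥ 1 vertices (no edges). Writing q = QEC(G), one has QEC(G ⊙ K̄_n) = ( (n+1)q − 2 + √( ((n+1)q − 2)² + 8q ) ) / 2. -/

import Mathlib

open scoped BigOperators
open Filter Topology
open scoped Classical

namespace QECPaper

/-- The cone (join) `K₁ + H` over a graph `H`: vertex `none` is the apex. -/
def cone {V₂ : Type*} (H : SimpleGraph V₂) : SimpleGraph (Option V₂) where
  Adj x y := (∃ a b, x = some a ∧ y = some b ∧ H.Adj a b) ∨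
    (x = none ∧ y ≠ none) ∨ (x ≠ none ∧ y = none)
  symm := by
    refine ⟨?_⟩
    rintro x y (⟨a, b, rfl, rfl, h⟩ | ⟨rfl, hy⟩ | ⟨hx, rfl⟩)
    · exact Or.inl ⟨b, a, rfl, rfl, h.symm⟩
    · exact Or.inr (Or.inr ⟨hy, rfl⟩)
    · exact Or.inr (Or.inl ⟨rfl, hx⟩)
  loopless := by
    refine ⟨?_⟩
    rintro x (⟨a, b, rfl, hb, h⟩ | ⟨rfl, hy⟩ | ⟨hx, rfl⟩)
    · exact H.loopless.irrefl a (by cases hb; exact h)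
    · exact hy rfl
    · exact hx rfl

/-- The corona `G ⊙ H` of two graphs, realized on `V₁ × ({o} ∪ V₂)`
with `o = none`. -/
def corona {V₁ V₂ : Type*} (G : SimpleGraph V₁) (H : SimpleGraph V₂) :
    SimpleGraph (V₁ × Option V₂) where
  Adj p q := (p.1 = q.1 ∧ (cone H).Adj p.2 q.2) ∨
    (G.Adj p.1 q.1 ∧ p.2 = none ∧ q.2 = none)
  symm := by
    refine ⟨?_⟩
    rintro ⟨i, x⟩ ⟨j, y⟩ (⟨h1, h2⟩ | ⟨h1, h2, h3⟩)
    · exact Or.inl ⟨h1.symm, (cone H).symm.symm _ _ h2⟩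
    · exact Or.inr ⟨h1.symm, h3, h2⟩
  loopless := by
    refine ⟨?_⟩
    rintro ⟨i, x⟩ (⟨h1, h2⟩ | ⟨h1, h2, h3⟩)
    · exact (cone H).loopless.irrefl x h2
    · exact G.loopless.irrefl i h1

/-- The quadratic embedding constant of a (connected) graph on a finite vertex set. -/
noncomputable def QEC {V : Type*} [Fintype V] (G : SimpleGraph V) : ℝ :=
  sSup {r : ℝ | ∃ f : V → ℝ, (∑ x, f x ^ 2) = 1 ∧ (∑ x, f x) = 0 ∧
    r = ∑ x, ∑ y, f x * (G.dist x y : ℝ) * f y}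

/-- The set `λ(S)` of `λ` appearing in a solution of the basic equations. -/
def lambdaS {V : Type*} [Fintype V] (G : SimpleGraph V) : Set ℝ :=
  {lam : ℝ | ∃ (f : V → ℝ) (μ : ℝ),
    (∀ x, (∑ y, (G.dist x y : ℝ) * f y) - lam * f x = μ / 2) ∧
    (∑ x, f x) = 0 ∧ (∑ x, f x ^ 2) = 1}

/-- The distance matrix of a graph, with real entries. -/
noncomputable def distMatrix {V : Type*} (G : SimpleGraph V) : Matrix V V ℝ :=
  Matrix.of fun x y => (G.dist x y : ℝ)

section MatrixFunctions

variable {ι : Type*} [Fintype ι] [DecidableEq ι]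

/-- The eigenspace `ker (A - α)` inside `EuclideanSpace ℝ ι`. -/
noncomputable def eigSpace (A : Matrix ι ι ℝ) (α : ℝ) :
    Submodule ℝ (EuclideanSpace ℝ ι) :=
  LinearMap.ker (Matrix.toEuclideanLin A - α • LinearMap.id)

/-- The all-ones vector of `EuclideanSpace ℝ ι`. -/
noncomputable def onesE (ι : Type*) [Fintype ι] : EuclideanSpace ℝ ι :=
  (WithLp.equiv 2 (ι → ℝ)).symm (fun _ => 1)

/-- `‖E_α 𝟏‖²`, where `E_α` is the orthogonal projection of `EuclideanSpace ℝ ι`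
onto the eigenspace `ker (A - α)`. -/
noncomputable def projNormSq (A : Matrix ι ι ℝ) (α : ℝ) : ℝ :=
  ‖(Submodule.orthogonalProjectionOnto (eigSpace A α) (onesE ι) : EuclideanSpace ℝ ι)‖ ^ 2

/-- The set of (real) eigenvalues of a matrix. -/
def evSet (A : Matrix ι ι ℝ) : Set ℝ :=
  {α : ℝ | ∃ v : ι → ℝ, v ≠ 0 ∧ A.mulVec v = α • v}

/-- The set of main eigenvalues: those `α` with `E_α 𝟏 ≠ 0`. -/
def mainEv (A : Matrix ι ι ℝ) : Set ℝ := {α : ℝ | projNormSq A α ≠ 0}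

/-- `k_A = |ev_M(A) \ {-2}|`. -/
noncomputable def kA (A : Matrix ι ι ℝ) : ℕ := (mainEv A \ {(-2 : ℝ)}).ncard

/-- The ω-function associated with the symmetric matrix `A`. -/
noncomputable def omegaFun (A : Matrix ι ι ℝ) (lam : ℝ) : ℝ :=
  1 + projNormSq A (-2) +
    ∑ᶠ α ∈ mainEv A \ {(-2 : ℝ)}, lam / (α + 2 + lam) * projNormSq A α

/-- The (maximal) domain of the ω-function: the complement of its poles. -/
def omegaDomain (A : Matrix ι ι ℝ) : Set ℝ :=
  {lam : ℝ | ∀ α ∈ mainEv A \ {(-2 : ℝ)}, lam ≠ -α - 2}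

/-- The set of zeroes of the ω-function (on its domain). -/
def omegaZeros (A : Matrix ι ι ℝ) : Set ℝ :=
  {lam : ℝ | lam ∈ omegaDomain A ∧ omegaFun A lam = 0}

/-- `λ*`, the largest zero of the ω-function. -/
noncomputable def lamStar (A : Matrix ι ι ℝ) : ℝ := sSup (omegaZeros A)

/-- The ψ-function associated with `A`: `ψ_A(λ) = λ/ω_A(λ)` extended
analytically across the poles of `ω_A` by the value `0`. -/
noncomputable def psiFun (A : Matrix ι ι ℝ) (lam : ℝ) : ℝ :=
  if -lam - 2 ∈ mainEv A \ {(-2 : ℝ)} then 0 else lam / omegaFun A lam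

/-- The inverse of the rightmost branch `ψ_{A*} = ψ_A ↾ (λ*, +∞)`:
`ψ_{A*}⁻¹(y)` is the unique `λ > λ*` with `ψ_A(λ) = y`. -/
noncomputable def psiStarInv (A : Matrix ι ι ℝ) (y : ℝ) : ℝ :=
  sSup {lam : ℝ | lamStar A < lam ∧ psiFun A lam = y}

end MatrixFunctions


/-- The quadratic form of the distance matrix of a graph. -/
noncomputable def distForm {V : Type*} [Fintype V] (G : SimpleGraph V) (f : V → ℝ) : ℝ :=
  ∑ x, ∑ y, f x * (G.dist x y : ℝ) * f y

lemma distForm_const_mul {V : Type*} [Fintype V] (G : SimpleGraph V) (c : ℝ) (f : V → ℝ) :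
    distForm G (fun x => c * f x) = c ^ 2 * distForm G f := by
  simp only [distForm, Finset.mul_sum]
  exact Finset.sum_congr rfl fun x _ => Finset.sum_congr rfl fun y _ => by ring

lemma bddAbove_distForm_unit {V : Type*} [Fintype V] (G : SimpleGraph V) :
    BddAbove {r : ℝ | ∃ f : V → ℝ, (∑ x, f x ^ 2) = 1 ∧ (∑ x, f x) = 0 ∧
      r = ∑ x, ∑ y, f x * (G.dist x y : ℝ) * f y} := by
  refine ⟨∑ x, ∑ y, (G.dist x y : ℝ), ?_⟩
  rintro r ⟨f, hf, -, rfl⟩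
  refine Finset.sum_le_sum fun x _ => Finset.sum_le_sum fun y _ => ?_
  have hsq (z : V) : f z ^ 2 ≤ 1 :=
    hf ▸ Finset.single_le_sum (f := fun x => f x ^ 2) (fun _ _ => sq_nonneg _) (Finset.mem_univ z)
  have hd : (0 : ℝ) ≤ G.dist x y := Nat.cast_nonneg _
  have hprod : f x * f y ≤ 1 := by nlinarith [sq_nonneg (f x - f y), hsq x, hsq y]
  nlinarith

lemma distForm_le_QEC_mul {V : Type*} [Fintype V] (G : SimpleGraph V) {f : V → ℝ}
    (hf : ∑ x, f x = 0) : distForm G f ≤ QEC G * ∑ x, f x ^ 2 := by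
  rcases (Finset.sum_nonneg fun x _ => sq_nonneg (f x) : 0 ≤ ∑ x, f x ^ 2).eq_or_lt with h | h
  · have hzero (x : V) : f x = 0 := by
      simpa using (Finset.sum_eq_zero_iff_of_nonneg fun x _ => sq_nonneg (f x)).1 h.symm x
        (Finset.mem_univ x)
    simp [distForm, hzero]
  · set s := ∑ x, f x ^ 2 with hs
    have hinv : (√s)⁻¹ ^ 2 = s⁻¹ := by rw [inv_pow, Real.sq_sqrt h.le]
    have hle : distForm G (fun x => (√s)⁻¹ * f x) ≤ QEC G := by
      refine le_csSup (bddAbove_distForm_unit G) ⟨_, ?_, ?_, rfl⟩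
      · simp_rw [mul_pow, ← Finset.mul_sum, hinv, ← hs]
        exact inv_mul_cancel₀ h.ne'
      · rw [← Finset.mul_sum, hf, mul_zero]
    rw [distForm_const_mul, hinv, inv_mul_le_iff₀ h] at hle
    linarith

lemma QEC_le_of_distForm_le {V : Type*} [Fintype V] (G : SimpleGraph V)
    (hV : 2 ≤ Fintype.card V) {C : ℝ}
    (hC : ∀ f : V → ℝ, ∑ x, f x = 0 → distForm G f ≤ C * ∑ x, f x ^ 2) : QEC G ≤ C := by
  refine csSup_le ?_ ?_
  · obtain ⟨a, b, hab⟩ := Fintype.exists_pair_of_one_lt_card hV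
    refine ⟨_, fun x => (√2)⁻¹ * ((if x = a then 1 else 0) - if x = b then 1 else 0), ?_, ?_, rfl⟩
    · have hsq (x : V) : ((if x = a then (1 : ℝ) else 0) - if x = b then 1 else 0) ^ 2 =
          (if x = a then 1 else 0) + if x = b then 1 else 0 := by
        by_cases h : x = a
        · simp [h, hab]
        · by_cases h' : x = b <;> simp [h, h', hab.symm]
      simp_rw [mul_pow, ← Finset.mul_sum, hsq, Finset.sum_add_distrib]
      norm_num
    · rw [← Finset.mul_sum, Finset.sum_sub_distrib]
      simp
  · rintro r ⟨f, hf, hf0, rfl⟩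
    simpa [hf, distForm] using hC f hf0

section Distance

variable {V₁ V₂ : Type*} (G : SimpleGraph V₁) (H : SimpleGraph V₂)

/-- The distance from a vertex of a cone to its apex. -/
def apexDist {V₂ : Type*} (x : Option V₂) : ℕ := x.elim 0 fun _ => 1

/-- The inclusion of `G` as the base of the corona. -/
def coronaBase : G →g corona G H where
  toFun i := (i, none)
  map_rel' h := Or.inr ⟨h, rfl, rfl⟩

lemma exists_walk_to_base (i : V₁) (x : Option V₂) :
    ∃ p : (corona G H).Walk (i, x) (i, none), p.length = apexDist x := by
  cases x with
  | none => exact ⟨.nil, rfl⟩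
  | some a =>
    have h : (corona G H).Adj (i, some a) (i, none) := Or.inl ⟨rfl, Or.inr (Or.inr (by simp))⟩
    exact ⟨h.toWalk, rfl⟩

lemma exists_walk_corona (hG : G.Connected) (p q : V₁ × Option V₂) :
    ∃ w : (corona G H).Walk p q,
      w.length = G.dist p.1 q.1 + apexDist p.2 + apexDist q.2 := by
  obtain ⟨i, x⟩ := p
  obtain ⟨j, y⟩ := q
  obtain ⟨w, hw⟩ : ∃ w : (corona G H).Walk (i, none) (j, none), w.length = G.dist i j := by
    obtain ⟨w, hw⟩ := (hG i j).exists_walk_length_eq_dist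
    exact ⟨w.map (coronaBase G H), (w.length_map _).trans hw⟩
  obtain ⟨w₁, h₁⟩ := exists_walk_to_base G H i x
  obtain ⟨w₂, h₂⟩ := exists_walk_to_base G H j y
  refine ⟨w₁.append (w.append w₂.reverse), ?_⟩
  rw [SimpleGraph.Walk.length_append, SimpleGraph.Walk.length_append,
    SimpleGraph.Walk.length_reverse]
  dsimp only
  omega

lemma dist_add_apexDist_le_length (hG : G.Connected) {p q : V₁ × Option V₂}
    (w : (corona G (⊥ : SimpleGraph V₂)).Walk p q) :
    G.dist p.1 q.1 + apexDist p.2 + apexDist q.2 ≤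
      w.length + if p = q then 2 * apexDist p.2 else 0 := by
  induction w with
  | nil => simp; omega
  | @cons p p' q h w ih =>
    rw [SimpleGraph.Walk.length_cons]
    obtain ⟨i, x⟩ := p
    obtain ⟨j, y⟩ := p'
    rcases h with ⟨rfl, ⟨a, b, -, -, hab⟩ | ⟨hx, hy⟩ | ⟨hx, hy⟩⟩ | ⟨hij, hx, hy⟩
    · exact hab.elim
    · obtain ⟨b, rfl⟩ := Option.ne_none_iff_exists'.1 hy
      dsimp only at hx ih ⊢
      subst hx
      simp only [apexDist, Option.elim] at ih ⊢
      split_ifs at ih <;> omega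
    · obtain ⟨b, rfl⟩ := Option.ne_none_iff_exists'.1 hx
      dsimp only at hy ih ⊢
      subst hy
      simp only [apexDist, Option.elim] at ih ⊢
      split_ifs at ih <;> omega
    · dsimp only at hx hy hij ih ⊢
      subst hx hy
      have htri := hG.dist_triangle (u := i) (v := j) (w := q.1)
      rw [SimpleGraph.dist_eq_one_iff_adj.2 hij] at htri
      simp only [apexDist, Option.elim] at ih ⊢
      split_ifs at ih <;> omega

lemma dist_corona_bot (hG : G.Connected) (p q : V₁ × Option V₂) :
    (corona G (⊥ : SimpleGraph V₂)).dist p q + (if p = q then 2 * apexDist p.2 else 0) =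
      G.dist p.1 q.1 + apexDist p.2 + apexDist q.2 := by
  obtain ⟨w, hw⟩ := exists_walk_corona G (⊥ : SimpleGraph V₂) hG p q
  obtain ⟨w', hw'⟩ := w.reachable.exists_walk_length_eq_dist
  have hlower := dist_add_apexDist_le_length G hG w'
  have hupper := SimpleGraph.dist_le w
  split_ifs with h
  · subst h
    simp; omega
  · rw [if_neg h] at hlower
    omega

end Distance

lemma distForm_corona_bot {V₁ V₂ : Type*} [Fintype V₁] [Fintype V₂] (G : SimpleGraph V₁)
    (hG : G.Connected) {f : V₁ × Option V₂ → ℝ} (hf : ∑ p, f p = 0) :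
    distForm (corona G (⊥ : SimpleGraph V₂)) f =
      distForm G (fun i => ∑ x, f (i, x)) - 2 * ∑ i, ∑ a, f (i, some a) ^ 2 := by
  have hdist (p q : V₁ × Option V₂) :
      ((corona G (⊥ : SimpleGraph V₂)).dist p q : ℝ) =
        G.dist p.1 q.1 + apexDist p.2 + apexDist q.2 -
          if p = q then 2 * (apexDist p.2 : ℝ) else 0 := by
    rw [eq_sub_iff_add_eq]
    exact_mod_cast dist_corona_bot G hG p q
  have hterm (p q : V₁ × Option V₂) :
      f p * ((corona G (⊥ : SimpleGraph V₂)).dist p q : ℝ) * f q =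
        f p * G.dist p.1 q.1 * f q + (f p * apexDist p.2) * f q + f p * (apexDist q.2 * f q) -
          if p = q then 2 * (apexDist p.2 * f p ^ 2) else 0 := by
    rw [hdist]
    split_ifs with h
    · subst h; ring
    · ring
  have hbase : ∑ p : V₁ × Option V₂, ∑ q : V₁ × Option V₂, f p * G.dist p.1 q.1 * f q =
      distForm G (fun i => ∑ x, f (i, x)) := by
    simp only [distForm, Fintype.sum_prod_type, Finset.sum_mul, Finset.mul_sum]
    refine Finset.sum_congr rfl fun i _ => ?_
    rw [Finset.sum_comm]
    refine Finset.sum_congr rfl fun j _ => ?_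
    rw [Finset.sum_comm]
  rw [distForm]
  simp_rw [hterm, Finset.sum_sub_distrib, Finset.sum_add_distrib, hbase, ← Finset.mul_sum, hf,
    ← Finset.sum_mul, hf]
  simp [Fintype.sum_prod_type, Fintype.sum_option, apexDist, Finset.mul_sum]

/-- A binary quadratic form with nonnegative diagonal and zero determinant is nonnegative. -/
lemma quadratic_nonneg_of_det_eq_zero {a c q : ℝ} (ha : 0 ≤ a) (hc : 0 ≤ c) (h : a * c = q ^ 2)
    (u s : ℝ) : 2 * q * u * s ≤ a * u ^ 2 + c * s ^ 2 := by
  rcases ha.eq_or_lt with rfl | ha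
  · have hq : q = 0 := by simpa using h.symm
    subst hq
    nlinarith [mul_nonneg hc (sq_nonneg s)]
  · refine le_of_mul_le_mul_left ?_ ha
    nlinarith [sq_nonneg (a * u - q * s)]

/-- `QEC(G ⊙ K̄ₙ)` for the empty graph `K̄ₙ` on `n ≥ 1` vertices. -/
theorem qec_corona_empty {V₁ : Type*} [Fintype V₁] (G : SimpleGraph V₁)
    (hG : G.Connected) (hV₁ : 2 ≤ Fintype.card V₁) (n : ℕ) (hn : 1 ≤ n) :
    QEC (corona G (⊥ : SimpleGraph (Fin n))) =
      (((n : ℝ) + 1) * QEC G - 2 +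
        Real.sqrt ((((n : ℝ) + 1) * QEC G - 2) ^ 2 + 8 * QEC G)) / 2 := by
  set q := QEC G
  set L := QEC (corona G (⊥ : SimpleGraph (Fin n))) with hL
  have hn0 : (0 : ℝ) < n := by exact_mod_cast hn
  have hdisc : (((n : ℝ) + 1) * q - 2) ^ 2 + 8 * q = ((n - 1) * q - 2) ^ 2 + 4 * n * q ^ 2 := by
    ring
  have hdisc0 : (0 : ℝ) ≤ ((n - 1) * q - 2) ^ 2 + 4 * n * q ^ 2 := by positivity
  set lam := (((n : ℝ) + 1) * q - 2 + √((((n : ℝ) + 1) * q - 2) ^ 2 + 8 * q)) / 2 with hlam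
  have habs : |((n : ℝ) - 1) * q - 2| ≤ √((((n : ℝ) + 1) * q - 2) ^ 2 + 8 * q) := by
    rw [hdisc]
    exact Real.abs_le_sqrt (by nlinarith [mul_nonneg hn0.le (sq_nonneg q)])
  obtain ⟨hneg, hpos⟩ := abs_le.1 habs
  have ha : 0 ≤ lam - q := by rw [hlam]; linarith
  have hc : 0 ≤ lam + 2 - n * q := by rw [hlam]; linarith
  have hroot : (lam - q) * (lam + 2 - n * q) = n * q ^ 2 := by
    have hsqrt := Real.sq_sqrt (hdisc ▸ hdisc0)
    rw [hlam]
    linear_combination hsqrt / 4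
  have hlam2 : lam + 2 ≠ 0 := by
    intro h
    have hq0 : q = 0 := by
      have : (n : ℝ) * q = 0 := by linear_combination (hroot - (lam - (n + 1) * q) * h) / 2
      simpa [hn0.ne'] using this
    have : √((((n : ℝ) + 1) * q - 2) ^ 2 + 8 * q) = 2 := by
      rw [hq0, show (((n : ℝ) + 1) * 0 - 2) ^ 2 + 8 * 0 = 2 ^ 2 by ring]
      exact Real.sqrt_sq (by norm_num)
    rw [hlam, this, hq0] at h
    norm_num at h
  apply le_antisymm
  · refine QEC_le_of_distForm_le _ ?_ fun f hf => ?_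
    · rw [Fintype.card_prod, Fintype.card_option]
      nlinarith [Nat.zero_le (Fintype.card (Fin n))]
    rw [distForm_corona_bot G hG hf]
    have hform : distForm G (fun i => ∑ x, f (i, x)) ≤ q * ∑ i, (∑ x, f (i, x)) ^ 2 :=
      distForm_le_QEC_mul G (by rwa [← Fintype.sum_prod_type])
    suffices h : ∀ i, q * (∑ x, f (i, x)) ^ 2 - 2 * ∑ a, f (i, some a) ^ 2 ≤
        lam * ∑ x, f (i, x) ^ 2 by
      have hsum := Finset.sum_le_sum fun i (_ : i ∈ Finset.univ) => h i
      rw [Finset.sum_sub_distrib, ← Finset.mul_sum, ← Finset.mul_sum, ← Finset.mul_sum,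
        ← Fintype.sum_prod_type (f := fun p => f p ^ 2)] at hsum
      linarith
    intro i
    rw [Fintype.sum_option, Fintype.sum_option]
    have hcs : (∑ a, f (i, some a)) ^ 2 ≤ n * ∑ a, f (i, some a) ^ 2 := by
      simpa using sq_sum_le_card_mul_sum_sq (s := Finset.univ) (f := fun a => f (i, some a))
    set u := f (i, none)
    set s := ∑ a, f (i, some a)
    set t := ∑ a, f (i, some a) ^ 2
    have hquad := quadratic_nonneg_of_det_eq_zero (q := n * q) (mul_nonneg hn0.le ha) hc
      (by linear_combination n * hroot) u s
    have hlam2' : 0 ≤ lam + 2 := by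
      by_contra! h
      have hq0 : q < 0 := by nlinarith
      nlinarith
    refine le_of_mul_le_mul_left ?_ hn0
    nlinarith [mul_le_mul_of_nonneg_left hcs hlam2']
  · set u := lam + 2 - n * q with hu
    have hw : 0 < u ^ 2 + n * q ^ 2 := by
      rcases eq_or_ne q 0 with h | h
      · have : u ≠ 0 := by rwa [hu, h, mul_zero, sub_zero]
        positivity
      · positivity
    have ht : 0 < (lam + 2) ^ 2 := by positivity
    have hqle : q ≤ (L * (u ^ 2 + n * q ^ 2) + 2 * n * q ^ 2) / (lam + 2) ^ 2 := by
      refine QEC_le_of_distForm_le G hV₁ fun g hg => ?_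
      set f : V₁ × Option (Fin n) → ℝ := fun p => (p.2.elim u fun _ => q) * g p.1 with hfdef
      have hfib (i : V₁) : ∑ x, f (i, x) = (lam + 2) * g i := by
        simp [hfdef, Fintype.sum_option, hu]
        ring
      have hf : ∑ p, f p = 0 := by
        rw [Fintype.sum_prod_type]
        simp_rw [hfib, ← Finset.mul_sum, hg, mul_zero]
      have hsq : ∑ p, f p ^ 2 = (u ^ 2 + n * q ^ 2) * ∑ i, g i ^ 2 := by
        rw [Fintype.sum_prod_type, Finset.mul_sum]
        refine Finset.sum_congr rfl fun i _ => ?_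
        simp [hfdef, Fintype.sum_option]
        ring
      have hsome : ∑ i, ∑ a, f (i, some a) ^ 2 = n * q ^ 2 * ∑ i, g i ^ 2 := by
        rw [Finset.mul_sum]
        refine Finset.sum_congr rfl fun i _ => ?_
        simp [hfdef]
        ring
      have hle := distForm_le_QEC_mul (corona G (⊥ : SimpleGraph (Fin n))) hf
      rw [distForm_corona_bot G hG hf, hsq, hsome, ← hL] at hle
      simp_rw [hfib] at hle
      rw [distForm_const_mul] at hle
      rw [div_mul_eq_mul_div, le_div_iff₀ ht]
      linarith
    rw [le_div_iff₀ ht] at hqle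
    refine le_of_mul_le_mul_right ?_ hw
    have hval : lam * (u ^ 2 + n * q ^ 2) = q * (lam + 2) ^ 2 - 2 * n * q ^ 2 := by
      linear_combination u * hroot + (n * q ^ 2 - q * (u + n * q + lam + 2)) * hu
    linarith

end QECPaper
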